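/- Consider ℝ³ with the Lorentz form ⟨x,y⟩ = x₁y₁ + x₂y₂ − x₃y₃. Let σ : I → ℝ³ be smooth with ⟨σ(s),σ(s)⟩ = 1 and ⟨σ'(s),σ'(s)⟩ = 1 for all s, with geodesic curvature vector k_g(s) = σ(s) + σ''(s) satisfying ⟨k_g(s),k_g(s)⟩ < 0 for all s, and let c(s) = k_g(s)/√(−⟨k_g(s),k_g(s)⟩). Then c'(s) = √(−⟨k_g(s),k_g(s)⟩)·σ'(s) for every s; in particular c'(s) ≠ 0, so the envelope curve c is regular. -/

import Mathlib

/-- The Lorentz bilinear form of signature (2,1) on ℝ³. -/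
noncomputable def lorentz3 (x y : Fin 3 → ℝ) : ℝ :=
  x 0 * y 0 + x 1 * y 1 - x 2 * y 2

theorem lorentz3_comm (x y : Fin 3 → ℝ) : lorentz3 x y = lorentz3 y x := by
  simp only [lorentz3]; ring

theorem lorentz3_add_left (x y z : Fin 3 → ℝ) :
    lorentz3 (x + y) z = lorentz3 x z + lorentz3 y z := by
  simp only [lorentz3, Pi.add_apply]; ring

theorem lorentz3_sub_left (x y z : Fin 3 → ℝ) :
    lorentz3 (x - y) z = lorentz3 x z - lorentz3 y z := by
  simp only [lorentz3, Pi.sub_apply]; ring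

theorem lorentz3_smul_left (a : ℝ) (x y : Fin 3 → ℝ) :
    lorentz3 (a • x) y = a * lorentz3 x y := by
  simp only [lorentz3, Pi.smul_apply, smul_eq_mul]; ring

theorem HasDerivAt.lorentz3 {f g : ℝ → Fin 3 → ℝ} {f' g' : Fin 3 → ℝ} {s : ℝ}
    (hf : HasDerivAt f f' s) (hg : HasDerivAt g g' s) :
    HasDerivAt (fun t => lorentz3 (f t) (g t)) (lorentz3 f' (g s) + lorentz3 (f s) g') s := by
  rw [hasDerivAt_pi] at hf hg
  have h := (((hf 0).mul (hg 0)).add ((hf 1).mul (hg 1))).sub ((hf 2).mul (hg 2))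
  refine h.congr_deriv ?_
  simp only [_root_.lorentz3]; ring

/-- The product rule for a pair of curves whose Lorentz product is constant. -/
theorem lorentz3_deriv_eq_neg_of_const {f g : ℝ → Fin 3 → ℝ} {f' g' : Fin 3 → ℝ} {s a : ℝ}
    (hf : HasDerivAt f f' s) (hg : HasDerivAt g g' s) (h : ∀ t, lorentz3 (f t) (g t) = a) :
    lorentz3 f' (g s) = -lorentz3 (f s) g' := by
  have h₁ := hf.lorentz3 hg
  simp only [h] at h₁
  linarith [h₁.unique (hasDerivAt_const s a)]

/-- A vector orthogonal to a Lorentz-orthonormal frame vanishes. -/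
theorem eq_zero_of_lorentz3_frame {x y z v : Fin 3 → ℝ}
    (hxx : lorentz3 x x = 1) (hyy : lorentz3 y y = 1) (hzz : lorentz3 z z = -1)
    (hxy : lorentz3 x y = 0) (hzx : lorentz3 z x = 0) (hzy : lorentz3 z y = 0)
    (hx : lorentz3 v x = 0) (hy : lorentz3 v y = 0) (hz : lorentz3 v z = 0) : v = 0 := by
  have hdet : (x 0 * (y 1 * z 2 - y 2 * z 1) - x 1 * (y 0 * z 2 - y 2 * z 0)
      + x 2 * (y 0 * z 1 - y 1 * z 0)) ^ 2 = 1 := by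
    have gram : (x 0 * (y 1 * z 2 - y 2 * z 1) - x 1 * (y 0 * z 2 - y 2 * z 0)
        + x 2 * (y 0 * z 1 - y 1 * z 0)) ^ 2 =
        -(lorentz3 x x * (lorentz3 y y * lorentz3 z z - lorentz3 z y ^ 2)
          - lorentz3 x y * (lorentz3 x y * lorentz3 z z - lorentz3 z y * lorentz3 z x)
          + lorentz3 z x * (lorentz3 x y * lorentz3 z y - lorentz3 y y * lorentz3 z x)) := by
      simp only [lorentz3]; ring
    rw [gram, hxx, hyy, hzz, hxy, hzx, hzy]; norm_num
  have hne := pow_ne_zero_iff (two_ne_zero) |>.1 (hdet.trans_ne one_ne_zero)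
  simp only [lorentz3] at hx hy hz
  ext i
  refine (mul_eq_zero.1 ?_).resolve_left hne
  fin_cases i <;> simp only [Fin.zero_eta, Fin.mk_one, Fin.reduceFinMk]
  · linear_combination (y 1 * z 2 - y 2 * z 1) * hx - (x 1 * z 2 - x 2 * z 1) * hy
      + (x 1 * y 2 - x 2 * y 1) * hz
  · linear_combination -(y 0 * z 2 - y 2 * z 0) * hx + (x 0 * z 2 - x 2 * z 0) * hy
      - (x 0 * y 2 - x 2 * y 0) * hz
  · linear_combination -(y 0 * z 1 - y 1 * z 0) * hx + (x 0 * z 1 - x 1 * z 0) * hy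
      - (x 0 * y 1 - x 1 * y 0) * hz

/-- For a regular canal `σ` in Λ² with time-like geodesic curvature vector, the
envelope curve `c = k_g/√(−⟨k_g,k_g⟩)` satisfies `c' = √(−⟨k_g,k_g⟩)·σ'`; in
particular `c' ≠ 0`, so the envelope is a regular curve. -/
theorem envelope_curve_is_regular
    (σ : ℝ → Fin 3 → ℝ) (hσ : ContDiff ℝ (⊤ : ℕ∞) σ)
    (hunit : ∀ s, lorentz3 (σ s) (σ s) = 1)
    (harc : ∀ s, lorentz3 (deriv σ s) (deriv σ s) = 1)
    (htime : ∀ s, lorentz3 (σ s + deriv (deriv σ) s) (σ s + deriv (deriv σ) s) < 0)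
    (c : ℝ → Fin 3 → ℝ)
    (hcdef : ∀ s, c s = (Real.sqrt
      (-(lorentz3 (σ s + deriv (deriv σ) s) (σ s + deriv (deriv σ) s))))⁻¹ •
        (σ s + deriv (deriv σ) s)) :
    ∀ s, deriv c s = Real.sqrt
        (-(lorentz3 (σ s + deriv (deriv σ) s) (σ s + deriv (deriv σ) s))) •
          deriv σ s ∧
      deriv c s ≠ 0 := by
  have hσ' : ContDiff ℝ (⊤ : ℕ∞) (deriv σ) := (contDiff_infty_iff_deriv.1 hσ).2
  have hσ'' : ContDiff ℝ (⊤ : ℕ∞) (deriv (deriv σ)) := (contDiff_infty_iff_deriv.1 hσ').2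
  have hd (s) : HasDerivAt σ (deriv σ s) s := (hσ.differentiable (by simp) s).hasDerivAt
  have hd' (s) : HasDerivAt (deriv σ) (deriv (deriv σ) s) s :=
    (hσ'.differentiable (by simp) s).hasDerivAt
  have hσσ' (s) : lorentz3 (σ s) (deriv σ s) = 0 := by
    have h := lorentz3_deriv_eq_neg_of_const (hd s) (hd s) hunit
    rw [lorentz3_comm] at h
    linarith
  have hσ'σ'' (s) : lorentz3 (deriv (deriv σ) s) (deriv σ s) = 0 := by
    have h := lorentz3_deriv_eq_neg_of_const (hd' s) (hd' s) harc
    rw [lorentz3_comm (deriv σ s)] at h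
    linarith
  have hσσ'' (s) : lorentz3 (deriv (deriv σ) s) (σ s) = -1 := by
    have h := lorentz3_deriv_eq_neg_of_const (hd s) (hd' s) hσσ'
    rw [harc, lorentz3_comm (σ s)] at h
    linarith
  set k : ℝ → Fin 3 → ℝ := fun s => σ s + deriv (deriv σ) s with hk
  change ∀ s, lorentz3 (k s) (k s) < 0 at htime
  change ∀ s, c s = (√(-lorentz3 (k s) (k s)))⁻¹ • k s at hcdef
  change ∀ s, deriv c s = √(-lorentz3 (k s) (k s)) • deriv σ s ∧ deriv c s ≠ 0
  have hkσ (s) : lorentz3 (k s) (σ s) = 0 := by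
    rw [hk, lorentz3_add_left, hunit, hσσ'']; norm_num
  have hkσ' (s) : lorentz3 (k s) (deriv σ s) = 0 := by
    rw [hk, lorentz3_add_left, hσσ', hσ'σ'']; norm_num
  have hpos (s) : 0 < √(-lorentz3 (k s) (k s)) := Real.sqrt_pos.2 (neg_pos.2 (htime s))
  have hsq (s) : √(-lorentz3 (k s) (k s)) ^ 2 = -lorentz3 (k s) (k s) :=
    Real.sq_sqrt (neg_pos.2 (htime s)).le
  have hcσ (s) : lorentz3 (c s) (σ s) = 0 := by
    rw [hcdef, lorentz3_smul_left, hkσ, mul_zero]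
  have hcσ' (s) : lorentz3 (c s) (deriv σ s) = 0 := by
    rw [hcdef, lorentz3_smul_left, hkσ', mul_zero]
  have hck (s) : lorentz3 (c s) (k s) = -√(-lorentz3 (k s) (k s)) := by
    rw [hcdef, lorentz3_smul_left, inv_mul_eq_iff_eq_mul₀ (hpos s).ne']
    linarith [hsq s]
  have hcc (s) : lorentz3 (c s) (c s) = -1 := by
    nth_rw 1 [hcdef]
    rw [lorentz3_smul_left, lorentz3_comm (k s) (c s), hck, mul_neg, inv_mul_cancel₀ (hpos s).ne']
  intro s
  have hkd (t) : DifferentiableAt ℝ k t :=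
    (hσ.differentiable (by simp) t).add (hσ''.differentiable (by simp) t)
  have hcd : HasDerivAt c (deriv c s) s := by
    rw [hasDerivAt_deriv_iff, funext hcdef]
    have h := ((hkd s).hasDerivAt.lorentz3 (hkd s).hasDerivAt).differentiableAt
    exact ((h.fun_neg.sqrt (neg_pos.2 (htime s)).ne').inv (hpos s).ne').smul (hkd s)
  have hcσ'' : lorentz3 (c s) (deriv (deriv σ) s) = -√(-lorentz3 (k s) (k s)) := by
    rw [← hck, lorentz3_comm (c s) (k s), hk, lorentz3_add_left, lorentz3_comm (σ s), hcσ,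
      zero_add, lorentz3_comm]
  have hc'σ := lorentz3_deriv_eq_neg_of_const hcd (hd s) hcσ
  have hc'σ' := lorentz3_deriv_eq_neg_of_const hcd (hd' s) hcσ'
  have hc'c := lorentz3_deriv_eq_neg_of_const hcd hcd hcc
  rw [hcσ'] at hc'σ
  rw [hcσ''] at hc'σ'
  rw [lorentz3_comm (c s)] at hc'c
  have key : deriv c s = √(-lorentz3 (k s) (k s)) • deriv σ s := by
    refine sub_eq_zero.1 (eq_zero_of_lorentz3_frame (hunit s) (harc s) (hcc s) (hσσ' s)
      (hcσ s) (hcσ' s) ?_ ?_ ?_) <;> rw [lorentz3_sub_left, lorentz3_smul_left]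
    · rw [hc'σ, lorentz3_comm (deriv σ s), hσσ']; norm_num
    · rw [hc'σ', harc]; ring
    · rw [lorentz3_comm (deriv σ s), hcσ']; linarith
  refine ⟨key, key ▸ smul_ne_zero (hpos s).ne' fun h => ?_⟩
  have h₁ := harc s
  simp [h, lorentz3] at h₁
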